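/- For every integer d ≥ 2 there exists a constant C_d > 0 such that for every positive integer N, one has 𝔠_d(N) ≥ (2 + 2/(d+1) − C_d/N)·(2N+1)^{d²+1}. -/

import Mathlib

/-- The number of pairs `(A,B)` of `d × d` integer matrices with all entries in
`[-N, N]` such that `A * B = B * A`. -/
noncomputable def matCommCount (d N : ℕ) : ℕ :=
  Nat.card {AB : Matrix (Fin d) (Fin d) ℤ × Matrix (Fin d) (Fin d) ℤ //
    (∀ i j, |AB.1 i j| ≤ (N : ℤ)) ∧ (∀ i j, |AB.2 i j| ≤ (N : ℤ)) ∧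
    AB.1 * AB.2 = AB.2 * AB.1}

open Finset in
/-- The integer matrices with all entries in `[-N, N]`. -/
noncomputable def matBox (d N : ℕ) : Finset (Matrix (Fin d) (Fin d) ℤ) :=
  Fintype.piFinset fun _ => Fintype.piFinset fun _ => Icc (-(N : ℤ)) N

theorem mem_matBox {d N : ℕ} {A : Matrix (Fin d) (Fin d) ℤ} :
    A ∈ matBox d N ↔ ∀ i j, |A i j| ≤ (N : ℤ) := by
  unfold matBox
  refine Fintype.mem_piFinset.trans (forall_congr' fun i => Fintype.mem_piFinset.trans
    (forall_congr' fun j => ?_))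
  rw [Finset.mem_Icc, abs_le]

theorem card_Icc_neg (N : ℕ) : (Finset.Icc (-(N : ℤ)) N).card = 2 * N + 1 := by
  rw [Int.card_Icc]
  lia

theorem card_matBox (d N : ℕ) : (matBox d N).card = (2 * N + 1) ^ d ^ 2 := by
  unfold matBox
  refine (Fintype.card_piFinset _).trans ?_
  simp only [Fintype.card_piFinset, card_Icc_neg, Finset.prod_const, Finset.card_univ,
    Fintype.card_fin]
  rw [← pow_mul, sq]

theorem scalar_mem_matBox {d N : ℕ} {a : ℤ} (ha : a ∈ Finset.Icc (-(N : ℤ)) N) :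
    Matrix.scalar (Fin d) a ∈ matBox d N := by
  rw [mem_matBox]
  intro i j
  rw [Finset.mem_Icc, ← abs_le] at ha
  rw [Matrix.scalar_apply, Matrix.diagonal_apply]
  split_ifs
  · exact ha
  · simp

theorem mem_Icc_of_scalar_mem_matBox {d N : ℕ} (hd : 0 < d) {a : ℤ}
    (ha : Matrix.scalar (Fin d) a ∈ matBox d N) : a ∈ Finset.Icc (-(N : ℤ)) N := by
  rw [mem_matBox] at ha
  have h := ha ⟨0, hd⟩ ⟨0, hd⟩
  rw [Matrix.scalar_apply, Matrix.diagonal_apply_eq] at h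
  rwa [Finset.mem_Icc, ← abs_le]

/-- The matrices which stay in the box after adding the scalar `c`. -/
theorem card_filter_add_scalar_mem_matBox {d N : ℕ} {c : ℤ} (hc : |c| ≤ 2 * N) :
    (((matBox d N).filter fun A => A + Matrix.scalar (Fin d) c ∈ matBox d N).card : ℤ) =
      (2 * N + 1) ^ (d ^ 2 - d) * (2 * N + 1 - |c|) ^ d := by
  have key : ((matBox d N).filter fun A => A + Matrix.scalar (Fin d) c ∈ matBox d N) =
      (Fintype.piFinset fun i => Fintype.piFinset fun j =>
        if i = j then Finset.Icc (max (-(N : ℤ)) (-N - c)) (min (N : ℤ) (N - c))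
        else Finset.Icc (-(N : ℤ)) N : Finset (Fin d → Fin d → ℤ)) := by
    ext A
    rw [Finset.mem_filter, mem_matBox, mem_matBox, ← forall_and]
    refine Iff.trans ?_ Fintype.mem_piFinset.symm
    refine forall_congr' fun i => ?_
    rw [Fintype.mem_piFinset, ← forall_and]
    refine forall_congr' fun j => ?_
    by_cases h : i = j
    · subst h
      simp only [Matrix.add_apply, Matrix.scalar_apply, Matrix.diagonal_apply_eq, if_true,
        Finset.mem_Icc, abs_le]
      lia
    · simp only [Matrix.add_apply, Matrix.scalar_apply, Matrix.diagonal_apply_ne _ h, add_zero,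
        and_self, if_neg h, Finset.mem_Icc, abs_le]
  have hcard : ((Finset.Icc (max (-(N : ℤ)) (-N - c)) (min (N : ℤ) (N - c))).card : ℤ) =
      2 * N + 1 - |c| := by
    rw [Int.card_Icc]
    rcases abs_cases c with h | h <;> lia
  rw [key]
  refine (congrArg _ (Fintype.card_piFinset _)).trans ?_
  simp only [Fintype.card_piFinset, apply_ite Finset.card, card_Icc_neg]
  push_cast
  simp only [hcard, Finset.prod_ite, Finset.prod_const, Finset.filter_eq, Finset.mem_univ,
    if_true, Finset.card_singleton, pow_one]
  have hne : ∀ i : Fin d, ({j | ¬ i = j} : Finset (Fin d)).card = d - 1 := by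
    intro i
    rw [Finset.filter_ne, Finset.card_erase_of_mem (Finset.mem_univ _), Finset.card_univ,
      Fintype.card_fin]
  simp only [hne, Finset.prod_const, Finset.card_univ, Fintype.card_fin]
  rw [mul_pow, ← pow_mul, mul_comm, Nat.sub_mul, one_mul, sq]

theorem pow_succ_le_mul_sum_pow (d n : ℕ) :
    (n : ℤ) ^ (d + 1) ≤ (d + 1) * ∑ k ∈ Finset.range n, ((k : ℤ) + 1) ^ d := by
  induction n with
  | zero => simp
  | succ n ih =>
    rw [Finset.sum_range_succ, mul_add]
    have h : ((n : ℤ) + 1) ^ (d + 1) - (n : ℤ) ^ (d + 1) ≤ (d + 1) * ((n : ℤ) + 1) ^ d := by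
      rw [← geom_sum₂_mul, add_sub_cancel_left, mul_one]
      refine (Finset.sum_le_card_nsmul _ _ (((n : ℤ) + 1) ^ d) fun i hi => ?_).trans (by simp)
      calc ((n : ℤ) + 1) ^ i * (n : ℤ) ^ (d + 1 - 1 - i)
          ≤ ((n : ℤ) + 1) ^ i * ((n : ℤ) + 1) ^ (d + 1 - 1 - i) := by gcongr; lia
        _ = ((n : ℤ) + 1) ^ d := by
          rw [← pow_add]
          congr 1
          have := Finset.mem_range.1 hi
          lia
    push_cast
    linarith

theorem le_sum_Icc_sub_abs_pow (d N : ℕ) :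
    2 * (2 * N + 1 : ℤ) ^ (d + 1) ≤ (d + 1) *
      (∑ c ∈ Finset.Icc (-(2 * N : ℕ) : ℤ) (2 * N : ℕ), (2 * N + 1 - |c|) ^ d +
        (2 * N + 1) ^ d) := by
  have h := pow_succ_le_mul_sum_pow d (2 * N + 1)
  rw [Finset.sum_Icc_of_even_eq_range (f := fun c : ℤ => (2 * N + 1 - |c|) ^ d)
    (fun c => by simp), ← Finset.sum_range_reflect]
  rw [show ∑ j ∈ Finset.range (2 * N + 1), (2 * (N : ℤ) + 1 - |((2 * N + 1 - 1 - j : ℕ) : ℤ)|) ^ d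
    = ∑ k ∈ Finset.range (2 * N + 1), ((k : ℤ) + 1) ^ d from Finset.sum_congr rfl fun k hk => by
      have := Finset.mem_range.1 hk
      rw [Nat.abs_cast]
      congr 1
      lia]
  push_cast at h
  simp only [abs_zero, sub_zero, two_nsmul]
  linarith

open Finset in
theorem matCommCount_ge {d : ℕ} (hd : 0 < d) (N : ℕ) :
    2 * (2 * N + 1 : ℤ) ^ (d ^ 2 + 1) + (2 * N + 1) ^ (d ^ 2 - d) *
      ∑ c ∈ Icc (-(2 * N : ℕ) : ℤ) (2 * N : ℕ), (2 * N + 1 - |c|) ^ d ≤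
      matCommCount d N + 2 * (2 * N + 1) ^ 2 := by
  classical
  have : Nonempty (Fin d) := ⟨⟨0, hd⟩⟩
  set I := Icc (-(N : ℤ)) N with hI
  set J := Icc (-(2 * N : ℕ) : ℤ) (2 * N : ℕ) with hJ
  set s := Matrix.scalar (Fin d) (α := ℤ) with hs
  have hsinj : Function.Injective s := fun _ _ h => Matrix.scalar_inj.1 h
  set P := (matBox d N ×ˢ matBox d N).filter fun AB => AB.1 * AB.2 = AB.2 * AB.1 with hP
  have hcount : matCommCount d N = P.card := by
    unfold matCommCount
    rw [← Nat.card_eq_finsetCard]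
    refine Nat.card_congr (Equiv.subtypeEquivRight fun AB => ?_)
    rw [hP, mem_filter, mem_product, mem_matBox, mem_matBox, and_assoc]
  set S₁ := (I ×ˢ matBox d N).image (fun p => (s p.1, p.2)) with hS₁
  set S₂ := (matBox d N ×ˢ I).image (fun p => (p.1, s p.2)) with hS₂
  set T := J.sigma (fun c => (matBox d N).filter fun A => A + s c ∈ matBox d N) with hT
  set S₃ := T.image (fun p => (p.2, p.2 + s p.1)) with hS₃
  set Q := (I ×ˢ I).image (fun p => (s p.1, s p.2)) with hQ
  have hIc : I.card = 2 * N + 1 := card_Icc_neg N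
  have c₁ : S₁.card = (2 * N + 1) ^ (d ^ 2 + 1) := by
    rw [hS₁, card_image_of_injective, card_product, hIc, card_matBox, pow_succ _ (d ^ 2), mul_comm]
    rintro ⟨a, A⟩ ⟨b, B⟩ h
    simp only [Prod.mk.injEq] at h ⊢
    exact ⟨hsinj h.1, h.2⟩
  have c₂ : S₂.card = (2 * N + 1) ^ (d ^ 2 + 1) := by
    rw [hS₂, card_image_of_injective, card_product, hIc, card_matBox, pow_succ _ (d ^ 2)]
    rintro ⟨A, a⟩ ⟨B, b⟩ h
    simp only [Prod.mk.injEq] at h ⊢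
    exact ⟨h.1, hsinj h.2⟩
  have c₃ : (S₃.card : ℤ) = (2 * N + 1) ^ (d ^ 2 - d) * ∑ c ∈ J, (2 * N + 1 - |c|) ^ d := by
    rw [hS₃, card_image_of_injective, hT, card_sigma, mul_sum]
    · push_cast
      refine sum_congr rfl fun c hc => card_filter_add_scalar_mem_matBox ?_
      rw [hJ, mem_Icc] at hc
      rw [abs_le]
      lia
    · rintro ⟨c, A⟩ ⟨c', A'⟩ h
      simp only [Prod.mk.injEq] at h
      obtain ⟨rfl, h⟩ := h
      rw [hsinj (add_left_cancel h)]
  have cQ : Q.card ≤ (2 * N + 1) ^ 2 := by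
    refine card_image_le.trans ?_
    rw [card_product, hIc, sq]
  have hcomm : ∀ a A, s a * A = A * s a := fun a A =>
    (Matrix.scalar_commute a (fun r => Commute.all a r) A).eq
  have hsub : (S₁ ∪ S₂) ∪ S₃ ⊆ P := by
    intro x hx
    rw [hP, mem_filter, mem_product]
    simp only [mem_union, hS₁, hS₂, hS₃, hT, mem_image, mem_product, mem_sigma, mem_filter] at hx
    rcases hx with (⟨⟨a, A⟩, h, rfl⟩ | ⟨⟨A, a⟩, h, rfl⟩) | ⟨⟨c, A⟩, h, rfl⟩
    · exact ⟨⟨scalar_mem_matBox h.1, h.2⟩, hcomm a A⟩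
    · exact ⟨⟨h.1, scalar_mem_matBox h.2⟩, (hcomm a A).symm⟩
    · exact ⟨⟨h.2.1, h.2.2⟩, by simp only [mul_add, add_mul, hcomm]⟩
  have hmemQ : ∀ a b, s a ∈ matBox d N → s b ∈ matBox d N → (s a, s b) ∈ Q := fun a b ha hb =>
    mem_image.2 ⟨(a, b), mem_product.2 ⟨mem_Icc_of_scalar_mem_matBox hd ha,
      mem_Icc_of_scalar_mem_matBox hd hb⟩, rfl⟩
  have i₁ : S₁ ∩ S₂ ⊆ Q := by
    intro x hx
    have hxP := hsub (mem_union_left _ (mem_union_left _ (mem_inter.1 hx).1))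
    rw [hP, mem_filter, mem_product] at hxP
    simp only [mem_inter, hS₁, hS₂, mem_image] at hx
    obtain ⟨⟨⟨a, A⟩, -, rfl⟩, ⟨⟨B, b⟩, -, h⟩⟩ := hx
    simp only [Prod.mk.injEq] at h hxP ⊢
    obtain ⟨-, rfl⟩ := h
    exact hmemQ a b hxP.1.1 hxP.1.2
  have i₂ : (S₁ ∪ S₂) ∩ S₃ ⊆ Q := by
    intro x hx
    have hxP := hsub (mem_union_left _ (mem_inter.1 hx).1)
    rw [hP, mem_filter, mem_product] at hxP
    simp only [mem_inter, mem_union, hS₁, hS₂, hS₃, mem_image] at hx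
    obtain ⟨⟨⟨a, A⟩, -, rfl⟩ | ⟨⟨A, a⟩, -, rfl⟩, ⟨⟨c, B⟩, -, h⟩⟩ := hx
    · simp only [Prod.mk.injEq] at h hxP ⊢
      obtain ⟨rfl, rfl⟩ := h
      rw [← map_add] at hxP ⊢
      exact hmemQ _ _ hxP.1.1 hxP.1.2
    · simp only [Prod.mk.injEq] at h hxP ⊢
      obtain ⟨rfl, h⟩ := h
      obtain rfl : B = s (a - c) := by rw [map_sub, ← h, add_sub_cancel_right]
      exact hmemQ _ _ hxP.1.1 hxP.1.2
  have e₁ := card_union_add_card_inter S₁ S₂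
  have e₂ := card_union_add_card_inter (S₁ ∪ S₂) S₃
  have l₁ := (card_le_card i₁).trans cQ
  have l₂ := (card_le_card i₂).trans cQ
  have l₃ := card_le_card hsub
  rw [← c₃, hcount]
  zify at c₁ c₂ e₁ e₂ l₁ l₂ l₃
  linarith

theorem commuting_lower_bound (d : ℕ) (hd : 2 ≤ d) :
    ∃ C : ℝ, 0 < C ∧ ∀ N : ℕ, 0 < N →
      (2 + 2 / ((d : ℝ) + 1) - C / (N : ℝ)) * (2 * (N : ℝ) + 1) ^ (d ^ 2 + 1) ≤
        (matCommCount d N : ℝ) := by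
  refine ⟨3, by norm_num, fun N hN => ?_⟩
  have hdd : d ≤ d ^ 2 := Nat.le_self_pow (by norm_num) d
  have h₁ : (2 * (2 * N + 1 : ℝ) ^ (d ^ 2 + 1) + (2 * N + 1) ^ (d ^ 2 - d) *
      ((∑ c ∈ Finset.Icc (-(2 * N : ℕ) : ℤ) (2 * N : ℕ), (2 * N + 1 - |c|) ^ d : ℤ) : ℝ)) ≤
      matCommCount d N + 2 * (2 * N + 1) ^ 2 :=
    mod_cast matCommCount_ge (by lia : 0 < d) N
  have h₂ : 2 * (2 * N + 1 : ℝ) ^ (d + 1) ≤ (d + 1) *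
      (((∑ c ∈ Finset.Icc (-(2 * N : ℕ) : ℤ) (2 * N : ℕ), (2 * N + 1 - |c|) ^ d : ℤ) : ℝ) +
        (2 * N + 1) ^ d) := mod_cast le_sum_Icc_sub_abs_pow d N
  generalize ((∑ c ∈ Finset.Icc (-(2 * N : ℕ) : ℤ) (2 * N : ℕ), (2 * N + 1 - |c|) ^ d : ℤ) : ℝ) = S
    at h₁ h₂
  have hN' : (0 : ℝ) < N := mod_cast hN
  have hM : (1 : ℝ) ≤ 2 * N + 1 := by linarith
  have hMN : (N : ℝ) ≤ 2 * N + 1 := by linarith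
  set M : ℝ := 2 * N + 1 with hMdef
  have h₃ : 2 / ((d : ℝ) + 1) * M ^ (d + 1) ≤ S + M ^ d := by
    rw [div_mul_eq_mul_div, div_le_iff₀ (by positivity)]
    linarith
  have h₄ : 2 / ((d : ℝ) + 1) * M ^ (d ^ 2 + 1) ≤ M ^ (d ^ 2 - d) * S + M ^ d ^ 2 := by
    have h := mul_le_mul_of_nonneg_left h₃ (by positivity : 0 ≤ M ^ (d ^ 2 - d))
    have e : M ^ (d ^ 2 + 1) = M ^ (d ^ 2 - d) * M ^ (d + 1) := by
      rw [← pow_add]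
      congr 1
      lia
    have e' : M ^ d ^ 2 = M ^ (d ^ 2 - d) * M ^ d := by
      rw [← pow_add]
      congr 1
      lia
    rw [e, e']
    linarith
  have h₅ : M ^ 2 ≤ M ^ d ^ 2 := pow_le_pow_right₀ hM (hd.trans hdd)
  have h₆ : M ^ d ^ 2 ≤ 1 / N * M ^ (d ^ 2 + 1) := by
    rw [div_mul_eq_mul_div, le_div_iff₀ hN', one_mul, pow_succ _ (d ^ 2)]
    gcongr
  have h₇ : (2 + 2 / ((d : ℝ) + 1) - 3 / (N : ℝ)) * M ^ (d ^ 2 + 1) =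
      2 * M ^ (d ^ 2 + 1) + 2 / ((d : ℝ) + 1) * M ^ (d ^ 2 + 1) -
        3 * (1 / N * M ^ (d ^ 2 + 1)) := by ring
  linarith
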